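/- Let m, n be positive integers, let A₁,...,Aₘ be n×n matrices with nonnegative real entries, and let α₁,...,αₘ be positive real numbers with α₁ + ⋯ + αₘ = 1. Then ‖A₁^(α₁) ∘ A₂^(α₂) ∘ ⋯ ∘ Aₘ^(αₘ)‖ ≤ ‖A₁‖^{α₁} ‖A₂‖^{α₂} ⋯ ‖Aₘ‖^{αₘ}. -/

import Mathlib

open scoped ENNReal NNReal BigOperators

/-- Spectral radius of a real matrix: the spectral radius of the corresponding
complex matrix (equivalently, the maximum modulus of its complex eigenvalues). -/
noncomputable def specRad {n : ℕ} (A : Matrix (Fin n) (Fin n) ℝ) : ℝ≥0∞ :=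
  spectralRadius ℂ (A.map (fun x => (x : ℂ)))

/-- Operator norm of a real `n × n` matrix induced by the Euclidean norm on `ℝⁿ`. -/
noncomputable def opNorm {n : ℕ} (A : Matrix (Fin n) (Fin n) ℝ) : ℝ :=
  ‖LinearMap.toContinuousLinearMap (Matrix.toEuclideanLin A)‖

/-- The weighted Hadamard (Schur) geometric mean `A₁^(α₁) ∘ ⋯ ∘ Aₘ^(αₘ)`. -/
noncomputable def hadWMean {n m : ℕ} (α : Fin m → ℝ)
    (A : Fin m → Matrix (Fin n) (Fin n) ℝ) : Matrix (Fin n) (Fin n) ℝ :=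
  Matrix.of fun x y => ∏ j, (A j x y) ^ (α j)

/-- The ordered product `A 0 * A 1 * ⋯ * A (k-1)`. -/
def matListProd {n k : ℕ} (A : Fin k → Matrix (Fin n) (Fin n) ℝ) :
    Matrix (Fin n) (Fin n) ℝ :=
  (List.ofFn A).prod

/-- The set `Σ^k` of all products of `k` elements of `S`. -/
def setPow {n : ℕ} (S : Set (Matrix (Fin n) (Fin n) ℝ)) (k : ℕ) :
    Set (Matrix (Fin n) (Fin n) ℝ) :=
  {B | ∃ A : Fin k → Matrix (Fin n) (Fin n) ℝ, (∀ i, A i ∈ S) ∧ B = matListProd A}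

/-- The set `Ψ₁ Ψ₂ ⋯ Ψₘ` of products with the `j`-th factor from `Ψ j`. -/
def setProd {n m : ℕ} (Ψ : Fin m → Set (Matrix (Fin n) (Fin n) ℝ)) :
    Set (Matrix (Fin n) (Fin n) ℝ) :=
  {B | ∃ A : Fin m → Matrix (Fin n) (Fin n) ℝ, (∀ j, A j ∈ Ψ j) ∧ B = matListProd A}

/-- The weighted Hadamard geometric mean `Ψ₁^(α₁) ∘ ⋯ ∘ Ψₘ^(αₘ)` of sets. -/
noncomputable def setHadWMean {n m : ℕ} (α : Fin m → ℝ)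
    (Ψ : Fin m → Set (Matrix (Fin n) (Fin n) ℝ)) :
    Set (Matrix (Fin n) (Fin n) ℝ) :=
  {B | ∃ A : Fin m → Matrix (Fin n) (Fin n) ℝ, (∀ j, A j ∈ Ψ j) ∧ B = hadWMean α A}

/-- The generalized spectral radius `ρ(Σ) = limsup_{k→∞} (sup_{A ∈ Σ^k} ρ(A))^{1/k}`. -/
noncomputable def genSpecRad {n : ℕ} (S : Set (Matrix (Fin n) (Fin n) ℝ)) : ℝ≥0∞ :=
  Filter.atTop.limsup fun k : ℕ => (⨆ B ∈ setPow S k, specRad B) ^ (1 / (k : ℝ))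

/-- The joint spectral radius `ρ̂(Σ) = limsup_{k→∞} (sup_{A ∈ Σ^k} ‖A‖)^{1/k}`. -/
noncomputable def jointSpecRad {n : ℕ} (S : Set (Matrix (Fin n) (Fin n) ℝ)) : ℝ≥0∞ :=
  Filter.atTop.limsup fun k : ℕ =>
    (⨆ B ∈ setPow S k, ENNReal.ofReal (opNorm B)) ^ (1 / (k : ℝ))

/-- Hölder's inequality for finitely many nonnegative functions on a finite set. -/
theorem sum_prod_rpow_le_prod_sum_rpow {ι κ : Type*} (s : Finset ι) (t : Finset κ)
    (f : κ → ι → ℝ) (hf : ∀ j ∈ t, ∀ i ∈ s, 0 ≤ f j i)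
    (w : κ → ℝ) (hw : ∀ j ∈ t, 0 < w j) (hw_sum : ∑ j ∈ t, w j = 1) :
    ∑ i ∈ s, ∏ j ∈ t, f j i ^ w j ≤ ∏ j ∈ t, (∑ i ∈ s, f j i) ^ w j := by
  have hS : ∀ j ∈ t, 0 ≤ ∑ i ∈ s, f j i := fun j hj => Finset.sum_nonneg (hf j hj)
  by_cases h : ∃ j ∈ t, ∑ i ∈ s, f j i = 0
  · obtain ⟨j, hj, h0⟩ := h
    rw [Finset.sum_eq_zero_iff_of_nonneg (hf j hj)] at h0
    rw [Finset.sum_eq_zero]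
    · exact Finset.prod_nonneg fun k hk => Real.rpow_nonneg (hS k hk) _
    · intro i hi
      refine Finset.prod_eq_zero hj ?_
      rw [h0 i hi, Real.zero_rpow (hw j hj).ne']
  · push Not at h
    calc ∑ i ∈ s, ∏ j ∈ t, f j i ^ w j
        = (∏ j ∈ t, (∑ i ∈ s, f j i) ^ w j) *
            ∑ i ∈ s, ∏ j ∈ t, (f j i / ∑ i ∈ s, f j i) ^ w j := by
          rw [Finset.mul_sum]
          refine Finset.sum_congr rfl fun i hi => ?_
          rw [← Finset.prod_mul_distrib]
          refine Finset.prod_congr rfl fun j hj => ?_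
          rw [← Real.mul_rpow (hS j hj) (div_nonneg (hf j hj i hi) (hS j hj)),
            mul_div_cancel₀ _ (h j hj)]
      _ ≤ (∏ j ∈ t, (∑ i ∈ s, f j i) ^ w j) *
            ∑ i ∈ s, ∑ j ∈ t, w j * (f j i / ∑ i ∈ s, f j i) := by
          refine mul_le_mul_of_nonneg_left (Finset.sum_le_sum fun i hi => ?_)
            (Finset.prod_nonneg fun j hj => Real.rpow_nonneg (hS j hj) _)
          exact Real.geom_mean_le_arith_mean_weighted t w _ (fun j hj => (hw j hj).le) hw_sum
            fun j hj => div_nonneg (hf j hj i hi) (hS j hj)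
      _ = ∏ j ∈ t, (∑ i ∈ s, f j i) ^ w j := by
          rw [Finset.sum_comm, Finset.sum_congr rfl fun j hj => ?_, hw_sum, mul_one]
          rw [← Finset.mul_sum, ← Finset.sum_div, div_self (h j hj), mul_one]

theorem inner_toEuclideanLin_eq_sum {n : ℕ} (A : Matrix (Fin n) (Fin n) ℝ)
    (u v : EuclideanSpace ℝ (Fin n)) :
    inner ℝ (Matrix.toEuclideanLin A v) u = ∑ p : Fin n × Fin n, A p.1 p.2 * u p.1 * v p.2 := by
  rw [Fintype.sum_prod_type]
  simp only [PiLp.inner_apply, Matrix.toLpLin_apply, Matrix.mulVec, dotProduct, RCLike.inner_apply,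
    conj_trivial, Finset.mul_sum]
  exact Finset.sum_congr rfl fun x _ => Finset.sum_congr rfl fun y _ => by ring

/-- The bilinear form of `A` at the entrywise absolute values of unit vectors is at most the
operator norm of `A`. -/
theorem sum_mul_abs_mul_abs_le_opNorm {n : ℕ} (A : Matrix (Fin n) (Fin n) ℝ)
    {u v : EuclideanSpace ℝ (Fin n)} (hu : ‖u‖ = 1) (hv : ‖v‖ = 1) :
    ∑ p : Fin n × Fin n, A p.1 p.2 * |u p.1| * |v p.2| ≤ opNorm A := by
  have norm_abs (w : EuclideanSpace ℝ (Fin n)) :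
      ‖(WithLp.toLp 2 fun i => |w i| : EuclideanSpace ℝ (Fin n))‖ = ‖w‖ := by
    simp [EuclideanSpace.norm_eq]
  let u' : EuclideanSpace ℝ (Fin n) := WithLp.toLp 2 fun i => |u i|
  let v' : EuclideanSpace ℝ (Fin n) := WithLp.toLp 2 fun i => |v i|
  calc ∑ p : Fin n × Fin n, A p.1 p.2 * |u p.1| * |v p.2|
      = inner ℝ (Matrix.toEuclideanLin A v') u' := (inner_toEuclideanLin_eq_sum A u' v').symm
    _ ≤ ‖Matrix.toEuclideanLin A v'‖ * ‖u'‖ := real_inner_le_norm _ _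
    _ ≤ opNorm A := by
      have h := (LinearMap.toContinuousLinearMap (Matrix.toEuclideanLin A)).le_opNorm v'
      rw [norm_abs, hv, mul_one] at h
      rw [norm_abs, hu, mul_one]
      exact h

/-- Theorem 2.2, inequality (7): norm of a weighted Hadamard geometric mean. -/
theorem hadamard_mean_opNorm_le {m n : ℕ} (hm : 0 < m) (hn : 0 < n)
    (A : Fin m → Matrix (Fin n) (Fin n) ℝ) (hA : ∀ j x y, 0 ≤ A j x y)
    (α : Fin m → ℝ) (hα : ∀ j, 0 < α j) (hαsum : ∑ j, α j = 1) :
    opNorm (hadWMean α A) ≤ ∏ j, opNorm (A j) ^ (α j) := by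
  refine ContinuousLinearMap.opNorm_le_of_re_inner_le
    (Finset.prod_nonneg fun j _ => Real.rpow_nonneg (norm_nonneg _) _) fun v u hv hu => ?_
  have hnonneg (j : Fin m) (p : Fin n × Fin n) : 0 ≤ A j p.1 p.2 * |u p.1| * |v p.2| :=
    mul_nonneg (mul_nonneg (hA j _ _) (abs_nonneg _)) (abs_nonneg _)
  calc RCLike.re (inner ℝ (Matrix.toEuclideanLin (hadWMean α A) v) u)
      = ∑ p : Fin n × Fin n, hadWMean α A p.1 p.2 * u p.1 * v p.2 :=
        inner_toEuclideanLin_eq_sum _ u v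
    _ ≤ ∑ p : Fin n × Fin n, hadWMean α A p.1 p.2 * |u p.1| * |v p.2| := by
      refine Finset.sum_le_sum fun p _ => ?_
      have hp : 0 ≤ hadWMean α A p.1 p.2 := by
        simp only [hadWMean, Matrix.of_apply]
        exact Finset.prod_nonneg fun j _ => Real.rpow_nonneg (hA j _ _) _
      rw [mul_assoc, mul_assoc, ← abs_mul]
      exact mul_le_mul_of_nonneg_left (le_abs_self _) hp
    _ = ∑ p : Fin n × Fin n, ∏ j, (A j p.1 p.2 * |u p.1| * |v p.2|) ^ α j := by
      refine Finset.sum_congr rfl fun p _ => ?_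
      simp_rw [mul_assoc, Real.mul_rpow (hA _ _ _) (mul_nonneg (abs_nonneg _) (abs_nonneg _))]
      rw [Finset.prod_mul_distrib, ← Real.rpow_sum_of_nonneg
        (mul_nonneg (abs_nonneg _) (abs_nonneg _)) fun j _ => (hα j).le, hαsum, Real.rpow_one]
      rfl
    _ ≤ ∏ j, (∑ p : Fin n × Fin n, A j p.1 p.2 * |u p.1| * |v p.2|) ^ α j :=
      sum_prod_rpow_le_prod_sum_rpow _ _ _ (fun j _ p _ => hnonneg j p) α (fun j _ => hα j) hαsum
    _ ≤ ∏ j, opNorm (A j) ^ α j :=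
      Finset.prod_le_prod
        (fun j _ => Real.rpow_nonneg (Finset.sum_nonneg fun p _ => hnonneg j p) _)
        fun j _ => Real.rpow_le_rpow (Finset.sum_nonneg fun p _ => hnonneg j p)
          (sum_mul_abs_mul_abs_le_opNorm (A j) hu hv) (hα j).le
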